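/- Fix λ ∈ [0,1). For every x > 0 the improper integral (1/2)∫ₓ^∞ Z(t)·F̂₁(t)/t dt converges, and it equals λ/(24(1 − λ²)) − (λx³ + 6(1 − 2λ²)x² + 12λ³x + 8λ² − 16)/(24(1 − λ²)·Z(x)³). Equivalently, the function Ê₁(x) = (λx³ + 6(1 − 2λ²)x² + 12λ³x + 8λ² − 16)/(24(1 − λ²)·Z(x)³) − λ/(24(1 − λ²)) satisfies Ê₁′(x) = Z(x)·F̂₁(x)/(2x) on (0,∞) and Ê₁(x) → 0 as x → +∞. -/

import Mathlib

open Filter MeasureTheory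

lemma quadratic_pos {l : ℝ} (hl0 : 0 ≤ l) (hl1 : l < 1) (x : ℝ) :
    0 < x ^ 2 - 4 * l * x + 4 := by
  nlinarith [sq_nonneg (x - 2 * l)]

/-- The explicit antiderivative. -/
lemma hasDerivAt_cubic_div_sqrt_quadratic_pow {l : ℝ} (hl0 : 0 ≤ l) (hl1 : l < 1) (x : ℝ) :
    HasDerivAt (fun x : ℝ =>
      (l * x ^ 3 + 6 * (1 - 2 * l ^ 2) * x ^ 2 + 12 * l ^ 3 * x + 8 * l ^ 2 - 16)
        / (24 * (1 - l ^ 2) * √(x ^ 2 - 4 * l * x + 4) ^ 3) - l / (24 * (1 - l ^ 2)))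
      (-(x ^ 3 - 16 * x + 4 * l ^ 2 * x + 16 * l) / (4 * √(x ^ 2 - 4 * l * x + 4) ^ 5)) x := by
  have hQ := quadratic_pos hl0 hl1 x
  have hl : 1 - l ^ 2 ≠ 0 := by nlinarith
  have hS : √(x ^ 2 - 4 * l * x + 4) ≠ 0 := (Real.sqrt_pos.2 hQ).ne'
  have hid := hasDerivAt_id' x
  have hnum := (((((hid.pow 3).const_mul l).add
    ((hid.pow 2).const_mul (6 * (1 - 2 * l ^ 2)))).add
    (hid.const_mul (12 * l ^ 3))).add_const (8 * l ^ 2)).sub_const 16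
  have hroot := (((hid.pow 2).sub (hid.const_mul (4 * l))).add_const 4).sqrt hQ.ne'
  have hden := (hroot.pow 3).const_mul (24 * (1 - l ^ 2))
  have h := (hnum.div hden (mul_ne_zero (mul_ne_zero (by norm_num) hl) (pow_ne_zero 3 hS))).sub_const
    (l / (24 * (1 - l ^ 2)))
  refine h.congr_deriv ?_
  simp only [Pi.add_apply, Pi.sub_apply, Pi.pow_apply]
  have hsq := Real.sq_sqrt hQ.le
  generalize √(x ^ 2 - 4 * l * x + 4) = s at hS hsq ⊢
  have hfour : s ^ 4 = (x ^ 2 - 4 * l * x + 4) ^ 2 := by rw [← hsq]; ring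
  field_simp
  simp only [hsq]
  ring_nf
  simp only [hfour]
  ring

lemma tendsto_cubic_div_sqrt_quadratic_pow {l : ℝ} (hl0 : 0 ≤ l) (hl1 : l < 1) :
    Tendsto (fun x : ℝ =>
      (l * x ^ 3 + 6 * (1 - 2 * l ^ 2) * x ^ 2 + 12 * l ^ 3 * x + 8 * l ^ 2 - 16)
        / (24 * (1 - l ^ 2) * √(x ^ 2 - 4 * l * x + 4) ^ 3) - l / (24 * (1 - l ^ 2)))
      atTop (nhds 0) := by
  have hl : 1 - l ^ 2 ≠ 0 := by nlinarith
  have hc : ContinuousAt (fun y : ℝ =>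
      (l + 6 * (1 - 2 * l ^ 2) * y + 12 * l ^ 3 * y ^ 2 + (8 * l ^ 2 - 16) * y ^ 3)
        / (24 * (1 - l ^ 2) * √(1 - 4 * l * y + 4 * y ^ 2) ^ 3) - l / (24 * (1 - l ^ 2))) 0 := by
    refine ContinuousAt.sub (ContinuousAt.div (by fun_prop) (by fun_prop) ?_) continuousAt_const
    simpa using hl
  have h := hc.tendsto.comp tendsto_inv_atTop_zero
  simp only [mul_zero, ne_eq, OfNat.ofNat_ne_zero, not_false_eq_true, zero_pow, add_zero, sub_zero,
    Real.sqrt_one, one_pow, mul_one, sub_self] at h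
  refine h.congr' ?_
  filter_upwards [eventually_gt_atTop 0] with x hx
  have hs : √(x ^ 2 - 4 * l * x + 4) = x * √(1 - 4 * l * x⁻¹ + 4 * x⁻¹ ^ 2) := by
    have hfac : x ^ 2 - 4 * l * x + 4 = x ^ 2 * (1 - 4 * l * x⁻¹ + 4 * x⁻¹ ^ 2) := by
      field_simp
    rw [hfac, Real.sqrt_mul (sq_nonneg x), Real.sqrt_sq hx.le]
  have hS : √(1 - 4 * l * x⁻¹ + 4 * x⁻¹ ^ 2) ≠ 0 := by
    intro h0
    rw [h0, mul_zero] at hs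
    exact (Real.sqrt_pos.2 (quadratic_pos hl0 hl1 x)).ne' hs
  simp only [Function.comp_apply]
  rw [hs]
  generalize √(1 - 4 * l * x⁻¹ + 4 * x⁻¹ ^ 2) = s at hS ⊢
  field_simp
  ring

/-- For `λ ∈ [0,1)` and `x > 0`, the improper integral
`½∫ₓ^∞ Z(t)F̂₁(t)/t dt` converges and equals
`λ/(24(1−λ²)) − (λx³ + 6(1−2λ²)x² + 12λ³x + 8λ² − 16)/(24(1−λ²)Z(x)³)`.
Equivalently `Ê₁′(x) = Z(x)F̂₁(x)/(2x)` on `(0,∞)` and `Ê₁(x) → 0` as `x → +∞`. -/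
theorem stmt_8 (l : ℝ) (hl0 : 0 ≤ l) (hl1 : l < 1)
    (Z F₁ E₁ : ℝ → ℝ)
    (hZ : ∀ x : ℝ, Z x = Real.sqrt (x ^ 2 - 4 * l * x + 4))
    (hF₁ : ∀ x : ℝ, F₁ x = -(x * (x ^ 3 - 16 * x + 4 * l ^ 2 * x + 16 * l))
      / (2 * (x ^ 2 - 4 * l * x + 4) ^ 3))
    (hE₁ : ∀ x : ℝ, E₁ x =
      (l * x ^ 3 + 6 * (1 - 2 * l ^ 2) * x ^ 2 + 12 * l ^ 3 * x + 8 * l ^ 2 - 16)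
        / (24 * (1 - l ^ 2) * (Z x) ^ 3) - l / (24 * (1 - l ^ 2))) :
    (∀ x : ℝ, 0 < x →
      IntegrableOn (fun t => Z t * F₁ t / t) (Set.Ioi x) volume ∧
      (1 / 2) * ∫ t in Set.Ioi x, Z t * F₁ t / t
        = l / (24 * (1 - l ^ 2))
          - (l * x ^ 3 + 6 * (1 - 2 * l ^ 2) * x ^ 2 + 12 * l ^ 3 * x + 8 * l ^ 2 - 16)
              / (24 * (1 - l ^ 2) * (Z x) ^ 3) ∧
      HasDerivAt E₁ (Z x * F₁ x / (2 * x)) x) ∧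
    Tendsto E₁ atTop (nhds 0) := by
  obtain rfl : Z = fun x => √(x ^ 2 - 4 * l * x + 4) := funext hZ
  obtain rfl := funext hE₁
  have hlim := tendsto_cubic_div_sqrt_quadratic_pow hl0 hl1
  have hderiv := hasDerivAt_cubic_div_sqrt_quadratic_pow hl0 hl1
  have hint : ∀ t : ℝ, 0 < t → √(t ^ 2 - 4 * l * t + 4) * F₁ t / t
      = 2 * (-(t ^ 3 - 16 * t + 4 * l ^ 2 * t + 16 * l) / (4 * √(t ^ 2 - 4 * l * t + 4) ^ 5)) := by
    intro t ht
    have hQ := quadratic_pos hl0 hl1 t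
    have hS : √(t ^ 2 - 4 * l * t + 4) ≠ 0 := (Real.sqrt_pos.2 hQ).ne'
    rw [hF₁]
    have hsq := Real.sq_sqrt hQ.le
    generalize √(t ^ 2 - 4 * l * t + 4) = s at hS hsq ⊢
    rw [← hsq]
    field_simp
    ring
  refine ⟨fun x hx => ?_, hlim⟩
  have hI : IntegrableOn (fun t : ℝ =>
      -(t ^ 3 - 16 * t + 4 * l ^ 2 * t + 16 * l) / (4 * √(t ^ 2 - 4 * l * t + 4) ^ 5))
      (Set.Ioi x) := by
    have hcont : Continuous (fun t : ℝ =>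
        -(t ^ 3 - 16 * t + 4 * l ^ 2 * t + 16 * l) / (4 * √(t ^ 2 - 4 * l * t + 4) ^ 5)) := by
      refine Continuous.div (by fun_prop) (by fun_prop) fun t => ?_
      have := Real.sqrt_pos.2 (quadratic_pos hl0 hl1 t)
      positivity
    rw [← Set.Ioc_union_Ioi_eq_Ioi (le_max_left x 4)]
    refine (hcont.integrableOn_Ioc).union
      (integrableOn_Ioi_deriv_of_nonpos' (fun t _ => hderiv t) (fun t ht => ?_) hlim)
    have ht4 : 4 < t := (le_max_right x 4).trans_lt ht
    refine div_nonpos_of_nonpos_of_nonneg (neg_nonpos.2 ?_) (by positivity)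
    have h1 : 0 ≤ t * (t ^ 2 - 16) := mul_nonneg (by linarith) (by nlinarith)
    have h2 : 0 ≤ 4 * l ^ 2 * t := by positivity
    linarith
  refine ⟨?_, ?_, ?_⟩
  · exact (integrableOn_congr_fun (fun t ht => hint t (hx.trans ht)) measurableSet_Ioi).2
      (hI.const_mul 2)
  · rw [setIntegral_congr_fun measurableSet_Ioi (fun t ht => hint t (hx.trans ht)),
      integral_const_mul, integral_Ioi_of_hasDerivAt_of_tendsto' (fun t _ => hderiv t) hI hlim]
    ring
  · refine (hderiv x).congr_deriv ?_
    simp only [mul_comm 2 x, ← div_div _ x 2, hint x hx]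
    ring
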